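/- Let i ≠ j be indices with M i j = 0 (an ∞-edge). Then for every small root v ∈ Σ, either σ_i(v) = v and σ_j(v) = v, or there exists a natural number N ≥ 1 such that (σ_i σ_j)^N (v) ∉ Σ. -/

import Mathlib

open scoped BigOperators

/-- The simple root `α_i`, the `i`-th standard basis vector of `ℝ^n`. -/
noncomputable def simpleRoot {n : ℕ} (i : Fin n) : Fin n → ℝ := Pi.single i 1

/-- The symmetric bilinear form `B` associated to the Coxeter matrix `M`, determined by
`B(α_i, α_j) = -cos (π / M i j)` when `M i j ≠ 0` and `B(α_i, α_j) = -1` when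
`M i j = 0` (the label `∞`). -/
noncomputable def bform {n : ℕ} (M : CoxeterMatrix (Fin n)) (u v : Fin n → ℝ) : ℝ :=
  ∑ i, ∑ j, u i * (if M i j = 0 then -1 else -Real.cos (Real.pi / (M i j))) * v j

/-- The simple reflection `σ_i(v) = v - 2 B(v, α_i) α_i`. -/
noncomputable def simpleRefl {n : ℕ} (M : CoxeterMatrix (Fin n)) (i : Fin n)
    (v : Fin n → ℝ) : Fin n → ℝ :=
  v - (2 * bform M v (simpleRoot i)) • simpleRoot i

/-- The set `Σ` of small roots of `M`: the smallest set of vectors containing the simple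
roots `α_1, …, α_n` and such that whenever `v ∈ Σ` and `-1 < B(v, α_i) < 0`, also
`σ_i(v) ∈ Σ`. -/
inductive IsSmallRoot {n : ℕ} (M : CoxeterMatrix (Fin n)) : (Fin n → ℝ) → Prop
  | simple (i : Fin n) : IsSmallRoot M (simpleRoot i)
  | reflect {v : Fin n → ℝ} (i : Fin n) : IsSmallRoot M v →
      -1 < bform M v (simpleRoot i) → bform M v (simpleRoot i) < 0 →
      IsSmallRoot M (simpleRefl M i v)

open CoxeterSystem

namespace SmallRoot

variable {n : ℕ} (M : CoxeterMatrix (Fin n))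

/-! ### The bilinear form and the simple reflections -/

/-- The form `bform M` as a bilinear form. -/
noncomputable def bilin : LinearMap.BilinForm ℝ (Fin n → ℝ) :=
  Matrix.toBilin' (Matrix.of fun i j : Fin n =>
    if M i j = 0 then (-1 : ℝ) else -Real.cos (Real.pi / (M i j)))

theorem bform_eq (u v : Fin n → ℝ) : bform M u v = bilin M u v := by
  simp only [bform, bilin, Matrix.toBilin'_apply, Matrix.of_apply]

theorem bilin_comm (u v : Fin n → ℝ) : bilin M u v = bilin M v u := by
  rw [← bform_eq, ← bform_eq, bform, bform, Finset.sum_comm]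
  refine Finset.sum_congr rfl fun i _ => Finset.sum_congr rfl fun j _ => ?_
  rw [M.symmetric i j]
  ring

theorem bilin_simpleRoot (i j : Fin n) : bilin M (simpleRoot i) (simpleRoot j) =
    if M i j = 0 then -1 else -Real.cos (Real.pi / (M i j)) := by
  simp [bilin, simpleRoot, Matrix.toBilin'_single]

theorem bilin_simpleRoot_self (i : Fin n) : bilin M (simpleRoot i) (simpleRoot i) = 1 := by
  simp [bilin_simpleRoot]

/-- The simple reflection as a linear endomorphism. -/
noncomputable def refl (i : Fin n) : Module.End ℝ (Fin n → ℝ) :=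
  LinearMap.id - (2 : ℝ) • ((bilin M).flip (simpleRoot i)).smulRight (simpleRoot i)

theorem refl_apply (i : Fin n) (v : Fin n → ℝ) :
    refl M i v = v - (2 * bilin M v (simpleRoot i)) • simpleRoot i := by
  simp [refl, mul_smul]

theorem simpleRefl_eq (i : Fin n) (v : Fin n → ℝ) : simpleRefl M i v = refl M i v := by
  rw [simpleRefl, refl_apply, bform_eq]

theorem refl_apply_of_ne {i k : Fin n} (h : k ≠ i) (v : Fin n → ℝ) : refl M i v k = v k := by
  simp [refl_apply, simpleRoot, h]

theorem refl_simpleRoot_self (i : Fin n) : refl M i (simpleRoot i) = -simpleRoot i := by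
  rw [refl_apply, bilin_simpleRoot_self]
  module

theorem refl_mul_self (i : Fin n) : refl M i * refl M i = 1 := by
  refine LinearMap.ext fun v => ?_
  rw [Module.End.mul_apply, Module.End.one_apply, refl_apply M i v, map_sub, map_smul,
    refl_simpleRoot_self, refl_apply]
  module

theorem bilin_refl_refl (i : Fin n) (u v : Fin n → ℝ) :
    bilin M (refl M i u) (refl M i v) = bilin M u v := by
  simp only [refl_apply, map_sub, map_smul, LinearMap.sub_apply, LinearMap.smul_apply,
    smul_eq_mul, bilin_simpleRoot_self, bilin_comm M (simpleRoot i)]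
  ring

/-! ### The geometric representation -/

/-- For `B(α_i, α_j) = -cos θ`, the vector at angle `φ` from `α_i` in the plane spanned by
`α_i` and `α_j`, scaled by `sin θ`. -/
noncomputable def planeVec (i j : Fin n) (θ φ : ℝ) : Fin n → ℝ :=
  Real.sin (φ + θ) • simpleRoot i + Real.sin φ • simpleRoot j

theorem refl_mul_refl_planeVec {i j : Fin n} {θ : ℝ}
    (h : bilin M (simpleRoot i) (simpleRoot j) = -Real.cos θ) (φ : ℝ) :
    refl M i (refl M j (planeVec i j θ φ)) = planeVec i j θ (φ + 2 * θ) := by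
  have h₁ := refl_apply M i (simpleRoot j)
  have h₂ := refl_apply M j (simpleRoot i)
  rw [bilin_comm, h] at h₁
  rw [h] at h₂
  have e₁ : Real.sin (φ + 2 * θ) = 2 * Real.cos θ * Real.sin (φ + θ) - Real.sin φ := by
    have := Real.sin_add (φ + θ) θ
    have h' := Real.sin_sub (φ + θ) θ
    rw [add_sub_cancel_right] at h'
    rw [show φ + 2 * θ = φ + θ + θ by ring]
    linarith
  have e₂ : Real.sin (φ + 2 * θ + θ) =
      2 * Real.cos θ * Real.sin (φ + 2 * θ) - Real.sin (φ + θ) := by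
    have := Real.sin_add (φ + 2 * θ) θ
    have h' := Real.sin_sub (φ + 2 * θ) θ
    rw [show φ + 2 * θ - θ = φ + θ by ring] at h'
    linarith
  simp only [planeVec, map_add, map_smul, map_sub, map_neg, h₁, h₂, refl_simpleRoot_self, e₂]
  simp only [e₁]
  module

theorem isLiftable_refl : M.IsLiftable (refl M) := by
  intro i j
  rcases eq_or_ne i j with rfl | hij
  · simp [refl_mul_self]
  rcases eq_or_ne (M i j) 0 with h0 | h0
  · simp [h0]
  have hm : (2 : ℝ) ≤ M i j := by
    have := M.off_diagonal i j hij
    exact_mod_cast (by omega : 2 ≤ M i j)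
  set θ : ℝ := Real.pi / M i j with hθ
  have hs : Real.sin θ ≠ 0 := by
    refine (Real.sin_pos_of_pos_of_lt_pi (by positivity) ?_).ne'
    rw [hθ, div_lt_iff₀ (by linarith)]
    nlinarith [Real.pi_pos]
  have hB : bilin M (simpleRoot i) (simpleRoot j) = -Real.cos θ := by
    simp [bilin_simpleRoot, h0, hθ]
  have hpow (k : ℕ) (φ : ℝ) : ((refl M i * refl M j) ^ k) (planeVec i j θ φ) =
      planeVec i j θ (φ + k * (2 * θ)) := by
    induction k with
    | zero => simp
    | succ k ih =>
      rw [pow_succ', Module.End.mul_apply, ih, Module.End.mul_apply,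
        refl_mul_refl_planeVec M hB]
      congr 1
      push_cast
      ring
  have hfix (φ : ℝ) :
      ((refl M i * refl M j) ^ M i j) (planeVec i j θ φ) = planeVec i j θ φ := by
    have h2 : (M i j : ℝ) * (2 * θ) = 2 * Real.pi := by
      rw [hθ]
      field_simp
    rw [hpow, h2, planeVec, planeVec, add_right_comm, Real.sin_add_two_pi, Real.sin_add_two_pi]
  have hi : simpleRoot i = (Real.sin θ)⁻¹ • planeVec i j θ 0 := by
    simp [planeVec, hs]
  have hj : simpleRoot j = (-(Real.sin θ)⁻¹) • planeVec i j θ (-θ) := by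
    simp [planeVec, hs]
  have hfi : ((refl M i * refl M j) ^ M i j) (simpleRoot i) = simpleRoot i := by
    rw [hi, map_smul, hfix]
  have hfj : ((refl M i * refl M j) ^ M i j) (simpleRoot j) = simpleRoot j := by
    rw [hj, map_smul, hfix]
  refine LinearMap.ext fun v => ?_
  set x := (bilin M v (simpleRoot i) + Real.cos θ * bilin M v (simpleRoot j)) / Real.sin θ ^ 2
    with hx
  set y := (bilin M v (simpleRoot j) + Real.cos θ * bilin M v (simpleRoot i)) / Real.sin θ ^ 2
    with hy
  have hc : Real.sin θ ^ 2 = 1 - Real.cos θ ^ 2 := by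
    linarith [Real.sin_sq_add_cos_sq θ]
  have hc0 : 1 - Real.cos θ ^ 2 ≠ 0 := hc ▸ pow_ne_zero 2 hs
  set p := v - x • simpleRoot i - y • simpleRoot j with hp
  have hpi : refl M i p = p := by
    have : bilin M p (simpleRoot i) = 0 := by
      rw [hp, map_sub, map_sub, LinearMap.sub_apply, LinearMap.sub_apply, map_smul, map_smul,
        LinearMap.smul_apply, LinearMap.smul_apply, bilin_simpleRoot_self,
        bilin_comm M (simpleRoot j), hB, hx, hy, hc]
      simp only [smul_eq_mul]
      field_simp
      ring
    rw [refl_apply, this]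
    simp
  have hpj : refl M j p = p := by
    have : bilin M p (simpleRoot j) = 0 := by
      rw [hp, map_sub, map_sub, LinearMap.sub_apply, LinearMap.sub_apply, map_smul, map_smul,
        LinearMap.smul_apply, LinearMap.smul_apply, bilin_simpleRoot_self, hB, hx, hy, hc]
      simp only [smul_eq_mul]
      field_simp
      ring
    rw [refl_apply, this]
    simp
  have hpk (k : ℕ) : ((refl M i * refl M j) ^ k) p = p := by
    induction k with
    | zero => simp
    | succ k ih => rw [pow_succ', Module.End.mul_apply, ih, Module.End.mul_apply, hpj, hpi]
  have hv : v = p + x • simpleRoot i + y • simpleRoot j := by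
    rw [hp]
    module
  rw [Module.End.one_apply]
  conv_lhs => rw [hv]
  rw [map_add, map_add, map_smul, map_smul, hpk, hfi, hfj, ← hv]

/-- The geometric representation of the Coxeter group of `M`. -/
noncomputable def geomRep : M.Group →* Module.End ℝ (Fin n → ℝ) :=
  M.toCoxeterSystem.lift ⟨refl M, isLiftable_refl M⟩

local notation "s" => CoxeterSystem.simple (CoxeterMatrix.toCoxeterSystem M)
local notation "ℓ" => CoxeterSystem.length (CoxeterMatrix.toCoxeterSystem M)
local notation "ρ" => geomRep M

theorem geomRep_simple (i : Fin n) : ρ (s i) = refl M i :=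
  M.toCoxeterSystem.lift_apply_simple (isLiftable_refl M) i

theorem geomRep_mul_apply (w w' : M.Group) (v : Fin n → ℝ) : ρ (w * w') v = ρ w (ρ w' v) := by
  rw [map_mul, Module.End.mul_apply]

theorem geomRep_inv_apply (w : M.Group) (v : Fin n → ℝ) : ρ w⁻¹ (ρ w v) = v := by
  rw [← geomRep_mul_apply, inv_mul_cancel, map_one, Module.End.one_apply]

theorem bilin_geomRep (w : M.Group) (u v : Fin n → ℝ) :
    bilin M (ρ w u) (ρ w v) = bilin M u v := by
  induction w using M.toCoxeterSystem.simple_induction_left with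
  | one => simp
  | mul_simple_left w i ih =>
    rw [geomRep_mul_apply, geomRep_mul_apply, geomRep_simple, bilin_refl_refl, ih]

/-! ### Positive and negative roots -/

/-- The nonnegative numbers `sin (k π / m) / sin (π / m)`, or `k` when `m = ∞`, are obtained by a
three-term recursion; they are the coordinates of the roots of a dihedral group. -/
theorem exists_dihedral_coeff (i j : Fin n) (hij : i ≠ j) : ∃ u : ℕ → ℝ, u 0 = 0 ∧ u 1 = 1 ∧
    (∀ k, u (k + 2) = -2 * bilin M (simpleRoot i) (simpleRoot j) * u (k + 1) - u k) ∧
    ∀ k, M i j = 0 ∨ k ≤ M i j → 0 ≤ u k := by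
  rcases eq_or_ne (M i j) 0 with h0 | h0
  · refine ⟨fun k => k, by simp, by simp, fun k => ?_, fun k _ => by positivity⟩
    simp only [bilin_simpleRoot, h0, if_true]
    push_cast
    ring
  · have hm : (2 : ℝ) ≤ M i j := by
      have := M.off_diagonal i j hij
      exact_mod_cast (by omega : 2 ≤ M i j)
    set θ : ℝ := Real.pi / M i j with hθ
    have hs : 0 < Real.sin θ := by
      refine Real.sin_pos_of_pos_of_lt_pi (by positivity) ?_
      rw [hθ, div_lt_iff₀ (by linarith)]
      nlinarith [Real.pi_pos]
    refine ⟨fun k => Real.sin (k * θ) / Real.sin θ, by simp, by simp [hs.ne'], fun k => ?_,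
      fun k hk => ?_⟩
    · rw [bilin_simpleRoot, if_neg h0, ← hθ]
      have h₁ := Real.sin_add ((k + 1 : ℝ) * θ) θ
      have h₂ := Real.sin_sub ((k + 1 : ℝ) * θ) θ
      rw [show (k + 1 : ℝ) * θ - θ = k * θ by ring] at h₂
      push_cast
      rw [show (k + 2 : ℝ) * θ = (k + 1 : ℝ) * θ + θ by ring, h₁, h₂]
      field_simp
      ring
    · refine div_nonneg (Real.sin_nonneg_of_nonneg_of_le_pi (by positivity) ?_) hs.le
      have hk' : (k : ℝ) ≤ M i j := by exact_mod_cast hk.resolve_left h0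
      rw [hθ, mul_div_assoc', div_le_iff₀ (by linarith), mul_comm]
      exact mul_le_mul_of_nonneg_left hk' Real.pi_pos.le

theorem geomRep_alternatingWord_simpleRoot {i j : Fin n} (hij : i ≠ j) {k : ℕ}
    (hk : M i j = 0 ∨ k < M i j) : ∃ x y : ℝ, 0 ≤ x ∧ 0 ≤ y ∧
      ρ (M.toCoxeterSystem.wordProd (alternatingWord i j k)) (simpleRoot i) =
        x • simpleRoot i + y • simpleRoot j := by
  obtain ⟨u, hu0, hu1, hu, hpos⟩ := exists_dihedral_coeff M i j hij
  have key : ρ (M.toCoxeterSystem.wordProd (alternatingWord i j k)) (simpleRoot i) =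
      if Even k then u (k + 1) • simpleRoot i + u k • simpleRoot j
      else u k • simpleRoot i + u (k + 1) • simpleRoot j := by
    clear hk
    induction k with
    | zero => simp [alternatingWord, hu0, hu1]
    | succ k ih =>
      rw [alternatingWord_succ', CoxeterSystem.wordProd_cons, geomRep_mul_apply, ih]
      by_cases he : Even k
      · rw [if_pos he, if_pos he, if_neg (by simpa [Nat.even_add_one] using he), geomRep_simple,
          map_add, map_smul, map_smul, refl_simpleRoot_self, refl_apply, hu]
        module
      · rw [if_neg he, if_neg he, if_pos (by simpa [Nat.even_add_one] using he), geomRep_simple,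
          map_add, map_smul, map_smul, refl_simpleRoot_self, refl_apply, hu,
          bilin_comm M (simpleRoot j)]
        module
  have h₁ := hpos k (hk.imp_right fun h => h.le)
  have h₂ := hpos (k + 1) (hk.imp_right fun h => h)
  rw [key]
  split_ifs
  exacts [⟨_, _, h₂, h₁, rfl⟩, ⟨_, _, h₁, h₂, rfl⟩]

theorem exists_append_alternatingWord (i j : Fin n) {m k : ℕ} (h : m ≤ k) :
    ∃ ω : List (Fin n), ω.length = k - m ∧
      alternatingWord i j k = ω ++ alternatingWord i j m := by
  induction k, h using Nat.le_induction with
  | base => exact ⟨[], by simp⟩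
  | succ k hk ih =>
    obtain ⟨ω, hl, hω⟩ := ih
    refine ⟨(if Even k then j else i) :: ω, ?_, ?_⟩
    · rw [List.length_cons, hl]
      omega
    · rw [alternatingWord_succ', hω, List.cons_append]

theorem lt_of_length_alternatingWord {i j : Fin n} {w v : M.Group} {k : ℕ} (h0 : M i j ≠ 0)
    (hw : w = v * M.toCoxeterSystem.wordProd (alternatingWord i j k)) (hl : ℓ w = ℓ v + k)
    (hi : ℓ w < ℓ (w * s i)) : k < M i j := by
  by_contra! hk
  obtain ⟨ω, hωl, hω⟩ := exists_append_alternatingWord i j hk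
  obtain ⟨m, hm⟩ := Nat.exists_eq_succ_of_ne_zero h0
  have hbraid : M.toCoxeterSystem.wordProd (alternatingWord i j (M i j)) =
      M.toCoxeterSystem.wordProd (alternatingWord i j m) * s i := by
    have := M.toCoxeterSystem.wordProd_braidWord_eq i j
    rw [braidWord, braidWord, M.symmetric j i] at this
    rw [this, hm, alternatingWord_succ, CoxeterSystem.wordProd_concat]
  have hws : w * s i = v * M.toCoxeterSystem.wordProd (ω ++ alternatingWord i j m) := by
    rw [hw, hω, CoxeterSystem.wordProd_append, CoxeterSystem.wordProd_append, hbraid]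
    simp only [mul_assoc, CoxeterSystem.simple_mul_simple_self, mul_one]
  have h₁ := M.toCoxeterSystem.length_mul_le v
    (M.toCoxeterSystem.wordProd (ω ++ alternatingWord i j m))
  have h₂ := M.toCoxeterSystem.length_wordProd_le (ω ++ alternatingWord i j m)
  rw [List.length_append, length_alternatingWord, hωl] at h₂
  rw [← hws] at h₁
  omega

theorem exists_maximal_alternatingWord {i j : Fin n} {w : M.Group}
    (hj : ℓ (w * s j) < ℓ w) : ∃ (v : M.Group) (k : ℕ), 1 ≤ k ∧
      w = v * M.toCoxeterSystem.wordProd (alternatingWord i j k) ∧ ℓ w = ℓ v + k ∧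
      ℓ v < ℓ (v * s i) ∧ ℓ v < ℓ (v * s j) := by
  let Q (k : ℕ) : Prop := ∃ v : M.Group,
    w = v * M.toCoxeterSystem.wordProd (alternatingWord i j k) ∧ ℓ w = ℓ v + k
  have hQ1 : Q 1 := by
    refine ⟨w * s j, ?_, ?_⟩
    · rw [alternatingWord_succ', alternatingWord, if_pos Even.zero,
        CoxeterSystem.wordProd_singleton, CoxeterSystem.simple_mul_simple_cancel_right]
    have := M.toCoxeterSystem.length_mul_simple w j
    omega
  obtain ⟨k, hk1, ⟨v, hv, hl⟩, hk⟩ : ∃ k, 1 ≤ k ∧ Q k ∧ ¬ Q (k + 1) := by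
    by_contra! h
    have hall (k : ℕ) : Q (k + 1) := by
      induction k with
      | zero => exact hQ1
      | succ k ih => exact h (k + 1) (by omega) ih
    obtain ⟨v, -, hl⟩ := hall (ℓ w)
    omega
  have hnext : ℓ v < ℓ (v * s (if Even k then j else i)) := by
    by_contra! hlt
    refine hk ⟨v * s (if Even k then j else i), ?_, ?_⟩
    · rw [alternatingWord_succ', CoxeterSystem.wordProd_cons, mul_assoc,
        CoxeterSystem.simple_mul_simple_cancel_left, hv]
    · have := M.toCoxeterSystem.length_mul_simple v (if Even k then j else i)
      omega
  have hprev : ℓ v < ℓ (v * s (if Even k then i else j)) := by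
    obtain ⟨k, rfl⟩ : ∃ k', k = k' + 1 := ⟨k - 1, by omega⟩
    have hif : (if Even (k + 1) then i else j) = if Even k then j else i := by
      by_cases he : Even k <;> simp [Nat.even_add_one, he]
    rw [alternatingWord_succ', CoxeterSystem.wordProd_cons, ← mul_assoc] at hv
    have h₁ := M.toCoxeterSystem.length_mul_le (v * s (if Even k then j else i))
      (M.toCoxeterSystem.wordProd (alternatingWord i j k))
    have h₂ := M.toCoxeterSystem.length_wordProd_le (alternatingWord i j k)
    have h₃ := M.toCoxeterSystem.length_mul_simple v (if Even k then j else i)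
    rw [length_alternatingWord] at h₂
    rw [← hv] at h₁
    rw [hif]
    omega
  refine ⟨v, k, hk1, hv, hl, ?_⟩
  by_cases he : Even k
  · simp only [he, if_true] at hnext hprev
    exact ⟨hprev, hnext⟩
  · simp only [he, if_false] at hnext hprev
    exact ⟨hnext, hprev⟩

theorem simpleRoot_nonneg (i : Fin n) : 0 ≤ (simpleRoot i : Fin n → ℝ) := by
  simp [simpleRoot]

theorem geomRep_simpleRoot_nonneg (w : M.Group) (i : Fin n) (hi : ℓ w < ℓ (w * s i)) :
    0 ≤ ρ w (simpleRoot i) := by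
  induction hN : ℓ w using Nat.strong_induction_on generalizing w i with
  | _ N ih =>
  subst hN
  rcases eq_or_ne w 1 with rfl | hw1
  · simpa using simpleRoot_nonneg i
  obtain ⟨j, hj⟩ := M.toCoxeterSystem.exists_rightDescent_of_ne_one hw1
  rw [CoxeterSystem.IsRightDescent] at hj
  have hij : i ≠ j := by
    rintro rfl
    omega
  obtain ⟨v, k, hk1, hv, hl, hvi, hvj⟩ := exists_maximal_alternatingWord M (i := i) hj
  have hk : M i j = 0 ∨ k < M i j := by
    by_cases h0 : M i j = 0
    · exact Or.inl h0
    · exact Or.inr (lt_of_length_alternatingWord M h0 hv hl hi)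
  obtain ⟨x, y, hx, hy, hxy⟩ := geomRep_alternatingWord_simpleRoot M hij hk
  rw [hv, geomRep_mul_apply, hxy, map_add, map_smul, map_smul]
  exact add_nonneg (smul_nonneg hx (ih _ (by omega) v i hvi rfl))
    (smul_nonneg hy (ih _ (by omega) v j hvj rfl))

/-- The roots of `M`: the images of the simple roots under the Coxeter group. -/
def IsRoot (β : Fin n → ℝ) : Prop := ∃ (w : M.Group) (i : Fin n), β = ρ w (simpleRoot i)

variable {M}

theorem isRoot_simpleRoot (i : Fin n) : IsRoot M (simpleRoot i) := ⟨1, i, by simp⟩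

theorem IsRoot.geomRep {β : Fin n → ℝ} (hβ : IsRoot M β) (w : M.Group) : IsRoot M (ρ w β) := by
  obtain ⟨w', i, rfl⟩ := hβ
  exact ⟨w * w', i, (geomRep_mul_apply M w w' _).symm⟩

theorem IsRoot.neg {β : Fin n → ℝ} (hβ : IsRoot M β) : IsRoot M (-β) := by
  obtain ⟨w, i, rfl⟩ := hβ
  exact ⟨w * s i, i, by rw [geomRep_mul_apply, geomRep_simple, refl_simpleRoot_self, map_neg]⟩

theorem IsRoot.bilin_self {β : Fin n → ℝ} (hβ : IsRoot M β) : bilin M β β = 1 := by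
  obtain ⟨w, i, rfl⟩ := hβ
  rw [bilin_geomRep, bilin_simpleRoot_self]

theorem IsRoot.ne_zero {β : Fin n → ℝ} (hβ : IsRoot M β) : β ≠ 0 := by
  rintro rfl
  simpa using hβ.bilin_self

theorem IsRoot.nonneg_or_nonpos {β : Fin n → ℝ} (hβ : IsRoot M β) : 0 ≤ β ∨ β ≤ 0 := by
  obtain ⟨w, i, rfl⟩ := hβ
  rcases lt_or_gt_of_ne (M.toCoxeterSystem.length_mul_simple_ne w i).symm with h | h
  · exact Or.inl (geomRep_simpleRoot_nonneg M w i h)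
  · right
    have := geomRep_simpleRoot_nonneg M (w * s i) i
      (by rwa [CoxeterSystem.simple_mul_simple_cancel_right])
    rw [geomRep_mul_apply, geomRep_simple, refl_simpleRoot_self, map_neg] at this
    exact neg_nonneg.mp this

/-- Every root has an associated reflection in the Coxeter group. -/
theorem IsRoot.exists_reflection {β : Fin n → ℝ} (hβ : IsRoot M β) :
    ∃ t : M.Group, ∀ u, ρ t u = u - (2 * bilin M u β) • β := by
  obtain ⟨w, i, rfl⟩ := hβ
  refine ⟨w * s i * w⁻¹, fun u => ?_⟩
  have hu : ρ w (ρ w⁻¹ u) = u := by simp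
  rw [geomRep_mul_apply, geomRep_mul_apply, geomRep_simple, refl_apply, map_sub, map_smul, hu,
    ← bilin_geomRep M w, hu]

theorem IsRoot.eq_simpleRoot {γ : Fin n → ℝ} (hγ : IsRoot M γ) (h0 : 0 ≤ γ) {i : Fin n}
    (hi : refl M i γ ≤ 0) : γ = simpleRoot i := by
  have hγi : γ = γ i • simpleRoot i := by
    ext k
    rcases eq_or_ne k i with rfl | hk
    · simp [simpleRoot]
    · have := hi k
      rw [refl_apply_of_ne M hk] at this
      simpa [simpleRoot, hk] using le_antisymm this (h0 k)
  have h1 := hγ.bilin_self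
  rw [hγi, map_smul, map_smul, LinearMap.smul_apply, bilin_simpleRoot_self] at h1
  have h2 : γ i = 1 := by
    have := h0 i
    simp only [Pi.zero_apply] at this
    simp only [smul_eq_mul, mul_one] at h1
    nlinarith
  rw [hγi, h2, one_smul]

theorem finite_inversions (w : M.Group) :
    {β | IsRoot M β ∧ 0 ≤ β ∧ ρ w β ≤ 0}.Finite := by
  induction w using M.toCoxeterSystem.simple_induction_left with
  | one =>
    refine Set.Finite.subset Set.finite_empty ?_
    rintro β ⟨hβ, h0, h1⟩
    exact hβ.ne_zero (le_antisymm (by simpa using h1) h0)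
  | mul_simple_left w i ih =>
    refine (ih.union (Set.finite_singleton (ρ w⁻¹ (simpleRoot i)))).subset ?_
    rintro β ⟨hβ, h0, h1⟩
    rcases (hβ.geomRep w).nonneg_or_nonpos with h | h
    · right
      rw [geomRep_mul_apply, geomRep_simple] at h1
      rw [Set.mem_singleton_iff, ← (hβ.geomRep w).eq_simpleRoot h h1, geomRep_inv_apply]
    · exact Or.inl ⟨hβ, h0, h⟩

/-! ### Dominance -/

/-- `β` dominates `γ` if every group element making `β` negative makes `γ` negative. -/
def Dominates (M : CoxeterMatrix (Fin n)) (β γ : Fin n → ℝ) : Prop :=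
  ∀ w : M.Group, geomRep M w β ≤ 0 → geomRep M w γ ≤ 0

/-- The orbit `r₀ = p`, `r₁ = q`, `r_{k+2} = 2 c r_{k+1} - r_k`. -/
def rotSeq (c : ℝ) (p q : Fin n → ℝ) : ℕ → Fin n → ℝ
  | 0 => p
  | 1 => q
  | k + 2 => (2 * c) • rotSeq c p q (k + 1) - rotSeq c p q k

theorem bilin_rotSeq {p q : Fin n → ℝ} (hp : IsRoot M p) (hq : IsRoot M q) (k : ℕ) :
    IsRoot M (rotSeq (bilin M p q) p q k) ∧ IsRoot M (rotSeq (bilin M p q) p q (k + 1)) ∧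
      bilin M (rotSeq (bilin M p q) p q k) (rotSeq (bilin M p q) p q (k + 1)) = bilin M p q := by
  induction k with
  | zero => exact ⟨hp, hq, rfl⟩
  | succ k ih =>
    obtain ⟨h₁, h₂, h₃⟩ := ih
    refine ⟨h₂, ?_, ?_⟩
    · obtain ⟨t, ht⟩ := h₂.exists_reflection
      have := (h₁.geomRep t).neg
      rwa [ht, h₃, neg_sub] at this
    · rw [rotSeq, map_sub, map_smul, h₂.bilin_self, bilin_comm M _ (rotSeq _ p q k), h₃,
        smul_eq_mul]
      ring

theorem dominates_of_one_le_bilin {β γ : Fin n → ℝ} (hβ : IsRoot M β) (hγ : IsRoot M γ)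
    (hγ0 : 0 ≤ γ) (hle : γ ≤ β) (h1 : 1 ≤ bilin M γ β) : Dominates M β γ := by
  intro w hw
  by_contra hγw
  have hγw0 := (hγ.geomRep w).nonneg_or_nonpos.resolve_right hγw
  set c := bilin M γ β with hc
  set r := rotSeq c γ β with hr
  obtain ⟨x, hx⟩ : ∃ x, 0 < ρ w γ x := by
    by_contra! h
    exact hγw h
  have hstep (k : ℕ) : 0 ≤ r k ∧ r k ≤ r (k + 1) ∧ ρ w (r (k + 1)) ≤ 0 ∧
      ρ w γ ≤ ρ w (r k) - ρ w (r (k + 1)) := by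
    induction k with
    | zero => exact ⟨hγ0, hle, hw, by simpa [hr, rotSeq] using hw⟩
    | succ k ih =>
      obtain ⟨h₁, h₂, h₃, h₄⟩ := ih
      have hrk : r (k + 2) = (2 * c) • r (k + 1) - r k := rfl
      have hd : ρ w γ ≤ ρ w (r (k + 1)) - ρ w (r (k + 2)) := by
        intro y
        have a₃ := h₃ y
        have a₄ := h₄ y
        rw [hrk, map_sub, map_smul]
        simp only [Pi.sub_apply, Pi.smul_apply, smul_eq_mul, Pi.zero_apply] at *
        nlinarith
      refine ⟨h₁.trans h₂, fun y => ?_, fun y => ?_, hd⟩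
      · have a₁ := h₁ y
        have a₂ := h₂ y
        rw [hrk]
        simp only [Pi.sub_apply, Pi.smul_apply, smul_eq_mul, Pi.zero_apply] at *
        nlinarith
      · have b₁ := hd y
        have b₂ := h₃ y
        have b₃ := hγw0 y
        simp only [Pi.sub_apply, Pi.zero_apply] at *
        linarith
  have hanti : StrictAnti fun k => ρ w (r (k + 1)) x := by
    refine strictAnti_nat_of_succ_lt fun k => ?_
    have := (hstep (k + 1)).2.2.2 x
    simp only [Pi.sub_apply] at this
    linarith
  have hinj : Function.Injective fun k => r (k + 1) := fun k l hkl =>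
    hanti.injective (by simpa using congrArg (fun v => ρ w v x) hkl)
  refine Set.infinite_of_injective_forall_mem hinj (fun k => ?_) (finite_inversions w)
  exact ⟨(bilin_rotSeq hγ hβ k).2.1, (hstep (k + 1)).1, (hstep k).2.2.1⟩

/-- A nonnegative solution of `c_{k+2} = 2 a c_{k+1} - c_k` with `a < 1` starts at zero. -/
theorem eq_zero_of_nonneg_recurrence {a : ℝ} (ha : a < 1) {c : ℕ → ℝ} (hc : ∀ k, 0 ≤ c k)
    (h : ∀ k, c (k + 2) = 2 * a * c (k + 1) - c k) : c 0 = 0 := by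
  have hd (k : ℕ) : c (k + 2) - c (k + 1) ≤ c (k + 1) - c k := by
    nlinarith [h k, hc (k + 1)]
  have hmono (k : ℕ) : c k ≤ c (k + 1) := by
    by_contra! hk
    have hlin (l : ℕ) : c (k + l + 1) - c (k + l) ≤ c (k + 1) - c k ∧
        c (k + l) ≤ c k + l * (c (k + 1) - c k) := by
      induction l with
      | zero => simp
      | succ l ih =>
        have := hd (k + l)
        rw [← add_assoc]
        push_cast
        exact ⟨by linarith, by linarith⟩
    obtain ⟨l, hl⟩ := exists_nat_gt (c k / (c k - c (k + 1)))
    rw [div_lt_iff₀ (by linarith)] at hl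
    linarith [(hlin l).2, hc (k + l)]
  by_contra h0
  have hpos : 0 < c 0 := lt_of_le_of_ne (hc 0) (Ne.symm h0)
  have hge (k : ℕ) : c 0 ≤ c k := monotone_nat_of_le_succ hmono (Nat.zero_le k)
  have hlin (l : ℕ) : c (l + 1) - c l ≤ c 1 - c 0 - l * (2 * (1 - a) * c 0) := by
    induction l with
    | zero => simp
    | succ l ih =>
      push_cast
      nlinarith [h l, hge (l + 1)]
  have hq : 0 < 2 * (1 - a) * c 0 := by nlinarith
  obtain ⟨l, hl⟩ := exists_nat_gt ((c 1 - c 0) / (2 * (1 - a) * c 0))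
  rw [div_lt_iff₀ hq] at hl
  linarith [hlin l, hmono l]

theorem not_dominates_of_bilin_lt_one {α β : Fin n → ℝ} (hα : IsRoot M α) (hβ : IsRoot M β)
    (hα0 : 0 ≤ α) (hβ0 : 0 ≤ β) (h1 : bilin M α β < 1) : ¬ Dominates M β α := by
  intro hdom
  set a := bilin M α β with ha
  set r := rotSeq a α β with hr
  have hno (w : M.Group) (hw : ρ w β ≤ 0) (hw' : 0 ≤ ρ w α) : False :=
    (hα.geomRep w).ne_zero (le_antisymm (hdom w hw) hw')
  have hstep (k : ℕ) : 0 ≤ r k ∧ 0 ≤ r (k + 1) ∧ ∃ w : M.Group,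
      (ρ w α = r k ∧ ρ w β = r (k + 1)) ∨ (ρ w α = -r (k + 1) ∧ ρ w β = -r k) := by
    induction k with
    | zero => exact ⟨hα0, hβ0, 1, Or.inl ⟨by simp [hr, rotSeq], by simp [hr, rotSeq]⟩⟩
    | succ k ih =>
      obtain ⟨-, h₂, w, hw⟩ := ih
      obtain ⟨-, hroot, hB⟩ := bilin_rotSeq hα hβ k
      obtain ⟨t, ht⟩ := hroot.exists_reflection
      have hrk : r (k + 2) = (2 * a) • r (k + 1) - r k := rfl
      have ht₁ : ρ t (r k) = -r (k + 2) := by rw [ht, hB, hrk, neg_sub]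
      have ht₂ : ρ t (r (k + 1)) = -r (k + 1) := by
        rw [ht, hroot.bilin_self]
        module
      have hw' : ∃ w : M.Group, (ρ w α = r (k + 1) ∧ ρ w β = r (k + 2)) ∨
          (ρ w α = -r (k + 2) ∧ ρ w β = -r (k + 1)) := by
        refine ⟨t * w, ?_⟩
        rw [geomRep_mul_apply, geomRep_mul_apply]
        rcases hw with ⟨h, h'⟩ | ⟨h, h'⟩
        · exact Or.inr ⟨by rw [h, ht₁], by rw [h', ht₂]⟩
        · exact Or.inl ⟨by rw [h, map_neg, ht₂, neg_neg], by rw [h', map_neg, ht₁, neg_neg]⟩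
      refine ⟨h₂, ?_, hw'⟩
      refine (bilin_rotSeq hα hβ (k + 1)).2.1.nonneg_or_nonpos.resolve_right fun hneg => ?_
      obtain ⟨w', ⟨h, h'⟩ | ⟨h, h'⟩⟩ := hw'
      · exact hno w' (h' ▸ hneg) (h ▸ h₂)
      · exact hno w' (h' ▸ neg_nonpos.mpr h₂) (h ▸ neg_nonneg.mpr hneg)
  refine hα.ne_zero (funext fun x => ?_)
  exact eq_zero_of_nonneg_recurrence h1 (c := fun k => r k x) (fun k => (hstep k).1 x) fun k => rfl

/-- A small root is a positive root dominating no other positive root. -/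
theorem isSmallRoot_spec {v : Fin n → ℝ} (hv : IsSmallRoot M v) : IsRoot M v ∧ 0 ≤ v ∧
    ∀ γ, IsRoot M γ → 0 ≤ γ → Dominates M v γ → γ = v := by
  induction hv with
  | simple i =>
    refine ⟨isRoot_simpleRoot i, simpleRoot_nonneg i, fun γ hγ h0 hdom => ?_⟩
    refine hγ.eq_simpleRoot h0 ?_
    rw [← geomRep_simple]
    refine hdom _ ?_
    rw [geomRep_simple, refl_simpleRoot_self]
    exact neg_nonpos.mpr (simpleRoot_nonneg i)
  | @reflect v i _ hgt hlt ih =>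
    obtain ⟨hroot, h0, hmin⟩ := ih
    rw [bform_eq] at hgt hlt
    rw [simpleRefl_eq]
    have hroot' : IsRoot M (refl M i v) := geomRep_simple M i ▸ hroot.geomRep (s i)
    have h0' : 0 ≤ refl M i v := by
      rw [refl_apply, sub_eq_add_neg, ← neg_smul]
      exact add_nonneg h0 (smul_nonneg (by linarith) (simpleRoot_nonneg i))
    have hinv (u : Fin n → ℝ) : refl M i (refl M i u) = u := by
      rw [← Module.End.mul_apply, refl_mul_self, Module.End.one_apply]
    refine ⟨hroot', h0', fun γ hγ hγ0 hdom => ?_⟩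
    have hγroot : IsRoot M (refl M i γ) := geomRep_simple M i ▸ hγ.geomRep (s i)
    rcases hγroot.nonneg_or_nonpos with hpos | hneg
    · rw [← hmin _ hγroot hpos fun w hw => ?_, hinv]
      rw [← geomRep_simple, ← geomRep_mul_apply]
      refine hdom _ ?_
      rwa [geomRep_mul_apply, geomRep_simple, hinv]
    · obtain rfl := hγ.eq_simpleRoot hγ0 hneg
      refine absurd hdom (not_dominates_of_bilin_lt_one hγ hroot' hγ0 h0' ?_)
      rw [← bilin_refl_refl M i, hinv, refl_simpleRoot_self, map_neg, LinearMap.neg_apply,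
        bilin_comm]
      linarith

theorem eq_of_isSmallRoot {v γ : Fin n → ℝ} (hv : IsSmallRoot M v) (hγ : IsRoot M γ)
    (hγ0 : 0 ≤ γ) (hle : γ ≤ v) (h1 : 1 ≤ bilin M γ v) : γ = v :=
  (isSmallRoot_spec hv).2.2 γ hγ hγ0
    (dominates_of_one_le_bilin (isSmallRoot_spec hv).1 hγ hγ0 hle h1)

/-- A small root `v` with `v_i ≥ 2` satisfies `B(v, α_i) < 1`. -/
theorem bilin_lt_one_of_isSmallRoot {v : Fin n → ℝ} (hv : IsSmallRoot M v) {i : Fin n}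
    (hi : 2 ≤ v i) : bilin M v (simpleRoot i) < 1 := by
  by_contra! h1
  have hle : simpleRoot i ≤ v := by
    intro k
    rcases eq_or_ne k i with rfl | hk
    · simp only [simpleRoot, Pi.single_eq_same]
      linarith
    · simpa [simpleRoot, hk] using (isSmallRoot_spec hv).2.1 k
  have := eq_of_isSmallRoot hv (isRoot_simpleRoot i) (simpleRoot_nonneg i) hle
    (by rwa [bilin_comm])
  rw [← this] at hi
  norm_num [simpleRoot] at hi

/-! ### Cycling along an infinite edge -/

variable {i j : Fin n}

theorem refl_refl_apply (hM : M i j = 0) (v : Fin n → ℝ) :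
    refl M i (refl M j v) = v
      + (-2 * (bilin M v (simpleRoot i) + 2 * bilin M v (simpleRoot j))) • simpleRoot i
      + (-2 * bilin M v (simpleRoot j)) • simpleRoot j := by
  have hB : bilin M (simpleRoot j) (simpleRoot i) = -1 := by
    rw [bilin_comm, bilin_simpleRoot, if_pos hM]
  rw [refl_apply M i, refl_apply M j]
  simp only [map_sub, map_smul, LinearMap.sub_apply, LinearMap.smul_apply, hB, smul_eq_mul]
  module

theorem bilin_refl_refl_simpleRoot (hM : M i j = 0) (v : Fin n → ℝ) :
    bilin M (refl M i (refl M j v)) (simpleRoot i) = bilin M v (simpleRoot i)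
        - 2 * (bilin M v (simpleRoot i) + bilin M v (simpleRoot j)) ∧
      bilin M (refl M i (refl M j v)) (simpleRoot j) = bilin M v (simpleRoot j)
        + 2 * (bilin M v (simpleRoot i) + bilin M v (simpleRoot j)) := by
  have hB : bilin M (simpleRoot i) (simpleRoot j) = -1 := by
    rw [bilin_simpleRoot, if_pos hM]
  rw [refl_refl_apply hM]
  simp only [map_add, map_smul, LinearMap.add_apply, LinearMap.smul_apply, hB,
    bilin_comm M (simpleRoot j) (simpleRoot i), bilin_simpleRoot_self, smul_eq_mul]
  constructor <;> ring

theorem bilin_iterate (hM : M i j = 0) (v : Fin n → ℝ) (N : ℕ) :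
    bilin M ((fun u => refl M i (refl M j u))^[N] v) (simpleRoot i) = bilin M v (simpleRoot i)
        - 2 * N * (bilin M v (simpleRoot i) + bilin M v (simpleRoot j)) ∧
      bilin M ((fun u => refl M i (refl M j u))^[N] v) (simpleRoot j) = bilin M v (simpleRoot j)
        + 2 * N * (bilin M v (simpleRoot i) + bilin M v (simpleRoot j)) := by
  induction N with
  | zero => simp
  | succ N ih =>
    rw [Function.iterate_succ_apply', (bilin_refl_refl_simpleRoot hM _).1,
      (bilin_refl_refl_simpleRoot hM _).2, ih.1, ih.2]
    push_cast
    constructor <;> ring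

theorem bilin_eq_zero_of_iterate_isSmallRoot (hij : i ≠ j) (hM : M i j = 0) (v : Fin n → ℝ)
    (h : ∀ N : ℕ, IsSmallRoot M ((fun u => refl M i (refl M j u))^[N] v)) :
    bilin M v (simpleRoot i) = 0 ∧ bilin M v (simpleRoot j) = 0 := by
  have hiter := bilin_iterate hM v
  have hnext (N : ℕ) := (Function.iterate_succ_apply' (fun u => refl M i (refl M j u)) N v).trans
    (refl_refl_apply hM _)
  have h0 (N : ℕ) := (isSmallRoot_spec (h N)).2.1
  set a := bilin M v (simpleRoot i) with ha
  set b := bilin M v (simpleRoot j) with hb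
  rcases lt_trichotomy (a + b) 0 with hs | hs | hs
  · obtain ⟨N, hN⟩ := exists_nat_gt ((1 - a) / (-2 * (a + b)))
    rw [div_lt_iff₀ (by linarith)] at hN
    have hge : 1 ≤ bilin M ((fun u => refl M i (refl M j u))^[N + 1] v) (simpleRoot i) := by
      rw [(hiter _).1]
      push_cast
      linarith
    refine absurd hge (not_le.mpr (bilin_lt_one_of_isSmallRoot (h _) ?_))
    have hi := congrFun (hnext N) i
    have hi0 := h0 N i
    rw [(hiter _).1] at hge
    rw [(hiter _).1, (hiter _).2] at hi
    simp only [Pi.add_apply, Pi.smul_apply, simpleRoot, Pi.single_eq_same,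
      Pi.single_eq_of_ne hij, smul_eq_mul, Pi.zero_apply] at hi hi0
    push_cast at hge
    linarith
  · have hba : b = -a := by linarith
    have hcyc := refl_refl_apply hM v
    rw [← ha, ← hb, hba] at hcyc
    have hB : bilin M v (refl M i (refl M j v)) = 1 := by
      rw [hcyc, map_add, map_add, map_smul, map_smul,
        (show IsRoot M v from (isSmallRoot_spec (h 0)).1).bilin_self, ← ha, ← hb, hba]
      simp only [smul_eq_mul]
      ring
    have heq : v = refl M i (refl M j v) := by
      have hδ : 0 ≤ (simpleRoot i + simpleRoot j : Fin n → ℝ) :=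
        add_nonneg (simpleRoot_nonneg i) (simpleRoot_nonneg j)
      have hdiff : refl M i (refl M j v) = v + (2 * a) • (simpleRoot i + simpleRoot j) := by
        rw [hcyc]
        module
      rcases le_total 0 a with h' | h'
      · refine eq_of_isSmallRoot (h 1) (isSmallRoot_spec (h 0)).1 (h0 0) ?_ hB.ge
        rw [hdiff]
        exact le_add_of_nonneg_right (smul_nonneg (by linarith) hδ)
      · refine (eq_of_isSmallRoot (h 0) (isSmallRoot_spec (h 1)).1 (h0 1) ?_ ?_).symm
        · change refl M i (refl M j v) ≤ v
          rw [hdiff]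
          exact add_le_of_nonpos_right (smul_nonpos_of_nonpos_of_nonneg (by linarith) hδ)
        · rw [bilin_comm]
          exact hB.ge
    have hj := congrFun (heq.trans hcyc) j
    simp only [Pi.add_apply, Pi.smul_apply, simpleRoot, Pi.single_eq_same,
      Pi.single_eq_of_ne hij.symm, smul_eq_mul] at hj
    constructor <;> linarith
  · obtain ⟨N, hN⟩ := exists_nat_gt ((1 - b) / (2 * (a + b)))
    rw [div_lt_iff₀ (by linarith)] at hN
    have hge : 1 ≤ bilin M ((fun u => refl M i (refl M j u))^[N] v) (simpleRoot j) := by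
      rw [(hiter _).2]
      linarith
    refine absurd hge (not_le.mpr (bilin_lt_one_of_isSmallRoot (h _) ?_))
    have hj := congrFun (hnext N) j
    have hj0 := h0 (N + 1) j
    simp only [Pi.add_apply, Pi.smul_apply, simpleRoot, Pi.single_eq_same,
      Pi.single_eq_of_ne hij.symm, smul_eq_mul, Pi.zero_apply] at hj hj0 hge
    linarith

end SmallRoot

/-- **Cycling lemma.** Let `i ≠ j` with `M i j = 0` (an `∞`-edge). Then for every small root
`v ∈ Σ`, either `v` is fixed by both `σ_i` and `σ_j`, or there exists `N ≥ 1` such that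
`(σ_i σ_j)^N (v) ∉ Σ`. -/
theorem cycling_lemma {n : ℕ} (hn : 3 ≤ n) (M : CoxeterMatrix (Fin n))
    (i j : Fin n) (hij : i ≠ j) (hMij : M i j = 0)
    (v : Fin n → ℝ) (hv : IsSmallRoot M v) :
    (simpleRefl M i v = v ∧ simpleRefl M j v = v) ∨
    ∃ N : ℕ, 1 ≤ N ∧
      ¬ IsSmallRoot M ((fun u => simpleRefl M i (simpleRefl M j u))^[N] v) := by
  by_contra! hcon
  obtain ⟨hfix, hsmall⟩ := hcon
  simp only [SmallRoot.simpleRefl_eq] at hfix hsmall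
  obtain ⟨hi, hj⟩ := SmallRoot.bilin_eq_zero_of_iterate_isSmallRoot hij hMij v fun N => by
    rcases Nat.eq_zero_or_pos N with rfl | hN
    · exact hv
    · exact hsmall N hN
  exact hfix (by simp [SmallRoot.refl_apply, hi]) (by simp [SmallRoot.refl_apply, hj])
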